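/- Assume 0 < p < 1/2 and set 𝔠 = (2+pq)/(pq). Fix n_0 ≥ 1, let λ_{n_0,0} < λ_{n_0,1} < ⋯ < λ_{n_0,3^{n_0}} be the eigenvalues of Δ_{n_0} in increasing order with corresponding eigenfunctions f_{n_0,k}, and let α_0, …, α_{3^{n_0}} be nonnegative reals with Σ_k α_k = 1. For n ≥ n_0 and 0 ≤ k ≤ 3^{n_0}, set λ_{n,k} = φ^{∘(n−n_0)}(λ_{n_0,k}) and let f_{n,k} be the function obtained from f_{n_0,k} by iterated spectral-decimation extension with parameters λ_{n_0+1,k}, …, λ_{n,k}. Let f_k = lim_{n→∞} f̃_{n,k} (the uniform limit on [0,1], which exists) and λ_k = lim_{n→∞} 𝔠^n λ_{n,k} (which exists); note λ_{n,1} > 0 and λ_1 > 0. Define u_n(x,t) = Σ_{k=0}^{3^{n_0}} α_k · f̃_{n,k}(x) · cos(t·√λ_{n,k}) and ũ(x,t) = Σ_{k=0}^{3^{n_0}} α_k · f_k(x) · cos(t·√λ_k). Then for every T > 0 there exists a constant C > 0 such that for all t ∈ [0,T] and all integers n > n_0: sup_{x ∈ [0,1]} | u_n(x, tπ/√λ_{n,1})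 − ũ(x, tπ/√λ_1) | ≤ C · max(t,1) · 𝔠^{−n}. -/

import Mathlib

noncomputable section

/-- Transition coefficients `a_{n,k}`: `a_{n+1,3k} = a_{n,k}`, `a_{n+1,3k+1} = q = 1-p`,
`a_{n+1,3k+2} = p`. -/
def a (p : ℝ) : ℕ → ℕ → ℝ
  | 0, _ => 0
  | n + 1, k =>
    if k % 3 = 1 then 1 - p
    else if k % 3 = 2 then p
    else a p n (k / 3)

/-- The Neumann discrete Laplacian `Δ_n`. -/
def lap (p : ℝ) (n : ℕ) (f : ℕ → ℝ) (k : ℕ) : ℝ :=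
  if k = 0 then f 0 - f 1
  else if k = 3 ^ n then f (3 ^ n) - f (3 ^ n - 1)
  else f k - a p n k * f (k - 1) - (1 - a p n k) * f (k + 1)

/-- The cubic polynomial `R(z) = z(z² − 3z + 2 + pq)/(pq)` with `q = 1 − p`. -/
def R (p z : ℝ) : ℝ := z * (z ^ 2 - 3 * z + 2 + p * (1 - p)) / (p * (1 - p))

/-- The spectral-decimation extension with parameter `z`. -/
def sdExt (p z : ℝ) (f : ℕ → ℝ) (m : ℕ) : ℝ :=
  if m % 3 = 0 then f (m / 3)
  else if m % 3 = 1 then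
    ((1 - p) * (1 - z) * f (m / 3) + p * (1 - p) * f (m / 3 + 1)) /
      ((1 - p - z) * (1 + p - z))
  else
    ((1 - p) * (1 - z) * f (m / 3 + 1) + p * (1 - p) * f (m / 3)) /
      ((1 - p - z) * (1 + p - z))

/-- Node points `x_{n,k}` with contraction ratio `r = p/(1+p)`. -/
def node (p : ℝ) : ℕ → ℕ → ℝ
  | 0, k => if k = 0 then 0 else 1
  | n + 1, m =>
    if m % 3 = 0 then node p n (m / 3)
    else if m % 3 = 1 then
      node p n (m / 3) + (p / (1 + p)) * (node p n (m / 3 + 1) - node p n (m / 3))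
    else
      node p n (m / 3 + 1) - (p / (1 + p)) * (node p n (m / 3 + 1) - node p n (m / 3))

open Classical in
/-- The piecewise-affine interpolation `f̃` of `f : {0,…,3^n} → ℝ`. -/
def interp (p : ℝ) (n : ℕ) (f : ℕ → ℝ) (x : ℝ) : ℝ :=
  let k := Nat.findGreatest (fun j => node p n j ≤ x ∧ j < 3 ^ n) (3 ^ n)
  f k + (f (k + 1) - f k) * (x - node p n k) / (node p n (k + 1) - node p n k)


/-- `f` is an eigenfunction of `Δ_n` with eigenvalue `z`. -/
def IsEigen (p : ℝ) (n : ℕ) (z : ℝ) (f : ℕ → ℝ) : Prop :=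
  (∃ k ≤ 3 ^ n, f k ≠ 0) ∧ ∀ k ≤ 3 ^ n, lap p n f k = z * f k

/-- The set of real eigenvalues of `Δ_n`. -/
def spec (p : ℝ) (n : ℕ) : Set ℝ := {z | ∃ f, IsEigen p n z f}

lemma a_mem_Icc {p : ℝ} (hp0 : 0 < p) (hp1 : p < 1) (n k : ℕ) : a p n k ∈ Set.Icc (0 : ℝ) 1 := by
  induction n generalizing k with
  | zero => simp [a]
  | succ n ih =>
    simp only [a]
    split_ifs
    · constructor <;> linarith
    · constructor <;> linarith
    · exact ih _

/-- By the maximum principle the spectrum of `Δ_n` lies in `[0, 2]`. -/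
lemma IsEigen.mem_Icc {p : ℝ} (hp0 : 0 < p) (hp1 : p < 1) {n : ℕ} {z : ℝ} {f : ℕ → ℝ}
    (h : IsEigen p n z f) : z ∈ Set.Icc (0 : ℝ) 2 := by
  obtain ⟨⟨k₁, hk₁, hf₁⟩, heq⟩ := h
  obtain ⟨k, hk, hmax⟩ := Finset.exists_max_image (Finset.range (3 ^ n + 1)) (fun k => |f k|)
    ⟨0, by simp⟩
  have hmax' : ∀ j ≤ 3 ^ n, |f j| ≤ |f k| := fun j hj => hmax j (by simp; omega)
  have hk' : k ≤ 3 ^ n := by simp at hk; omega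
  have hpos : 0 < |f k| := (abs_pos.2 hf₁).trans_le (hmax' k₁ hk₁)
  have h3 : 1 ≤ 3 ^ n := Nat.one_le_pow _ _ (by norm_num)
  have key : |(1 - z) * f k| ≤ |f k| := by
    have e := heq k hk'
    unfold lap at e
    split_ifs at e with h0 h1
    · rw [show (1 - z) * f k = f 1 by subst h0; linarith]
      exact hmax' 1 h3
    · rw [show (1 - z) * f k = f (3 ^ n - 1) by subst h1; linarith]
      exact hmax' _ (by omega)
    · rw [show (1 - z) * f k = a p n k * f (k - 1) + (1 - a p n k) * f (k + 1) by linarith]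
      obtain ⟨ha0, ha1⟩ := a_mem_Icc hp0 hp1 n k
      have hl := abs_le.1 (hmax' (k - 1) (by omega))
      have hr := abs_le.1 (hmax' (k + 1) (by omega))
      rw [abs_le]
      constructor <;> nlinarith
  rw [abs_mul] at key
  have : |1 - z| ≤ 1 := by
    by_contra! hc
    nlinarith
  have := abs_le.1 this
  constructor <;> linarith

lemma node_zero (p : ℝ) (n : ℕ) : node p n 0 = 0 := by
  induction n with
  | zero => simp [node]
  | succ n ih => simpa [node] using ih

lemma node_three_pow (p : ℝ) (n : ℕ) : node p n (3 ^ n) = 1 := by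
  induction n with
  | zero => simp [node]
  | succ n ih => simpa [node, pow_succ] using ih

lemma node_three_mul (p : ℝ) (n k : ℕ) : node p (n + 1) (3 * k) = node p n k := by
  simp [node]

lemma node_three_mul_add_one (p : ℝ) (n k : ℕ) : node p (n + 1) (3 * k + 1) =
    node p n k + (p / (1 + p)) * (node p n (k + 1) - node p n k) := by
  have h1 : (3 * k + 1) % 3 = 1 := by omega
  have h2 : (3 * k + 1) / 3 = k := by omega
  simp [node, h1, h2]

lemma node_three_mul_add_two (p : ℝ) (n k : ℕ) : node p (n + 1) (3 * k + 2) =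
    node p n (k + 1) - (p / (1 + p)) * (node p n (k + 1) - node p n k) := by
  have h1 : (3 * k + 2) % 3 = 2 := by omega
  have h2 : (3 * k + 2) / 3 = k := by omega
  simp [node, h1, h2]

lemma exists_eq_three_mul_add (K : ℕ) : ∃ k, K = 3 * k ∨ K = 3 * k + 1 ∨ K = 3 * k + 2 :=
  ⟨K / 3, by omega⟩

lemma ratio_pos {p : ℝ} (hp0 : 0 < p) : 0 < p / (1 + p) := by positivity

lemma ratio_lt_half {p : ℝ} (hp0 : 0 < p) (hp1 : p < 1) : p / (1 + p) < 1 / 2 := by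
  rw [div_lt_div_iff₀ (by linarith) (by norm_num)]
  linarith

lemma node_lt_succ {p : ℝ} (hp0 : 0 < p) (hp1 : p < 1) {n k : ℕ} (hk : k < 3 ^ n) :
    node p n k < node p n (k + 1) := by
  induction n generalizing k with
  | zero =>
    obtain rfl : k = 0 := by simpa using hk
    simp [node]
  | succ n ih =>
    have hr0 := ratio_pos hp0
    have hr1 := ratio_lt_half hp0 hp1
    rw [pow_succ] at hk
    obtain ⟨j, rfl | rfl | rfl⟩ := exists_eq_three_mul_add k
    · rw [node_three_mul, node_three_mul_add_one]
      nlinarith [ih (k := j) (by omega)]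
    · rw [node_three_mul_add_one, node_three_mul_add_two]
      nlinarith [ih (k := j) (by omega)]
    · rw [show 3 * j + 2 + 1 = 3 * (j + 1) by ring, node_three_mul, node_three_mul_add_two]
      nlinarith [ih (k := j) (by omega)]

lemma node_mono {p : ℝ} (hp0 : 0 < p) (hp1 : p < 1) {n j k : ℕ} (hjk : j ≤ k) (hk : k ≤ 3 ^ n) :
    node p n j ≤ node p n k := by
  induction k, hjk using Nat.le_induction with
  | base => exact le_rfl
  | succ k _ ih => exact (ih (by omega)).trans (node_lt_succ hp0 hp1 (by omega)).le

/-- The point `x` lies in the `k`-th cell of level `n`; cells are half-open except the last. -/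
def MemCell (p : ℝ) (n k : ℕ) (x : ℝ) : Prop :=
  k < 3 ^ n ∧ node p n k ≤ x ∧ x ≤ node p n (k + 1) ∧ (x < node p n (k + 1) ∨ k + 1 = 3 ^ n)

lemma exists_memCell {p : ℝ} (n : ℕ) {x : ℝ} (hx : x ∈ Set.Icc (0 : ℝ) 1) :
    ∃ k, MemCell p n k x := by
  classical
  set P : ℕ → Prop := fun j => node p n j ≤ x ∧ j < 3 ^ n
  have h0 : P 0 := ⟨by rw [node_zero]; exact hx.1, by positivity⟩
  obtain ⟨h1, h2⟩ := Nat.findGreatest_spec (P := P) (Nat.zero_le (3 ^ n)) h0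
  set k := Nat.findGreatest P (3 ^ n)
  have hor : x < node p n (k + 1) ∨ k + 1 = 3 ^ n := by
    rcases eq_or_ne (k + 1) (3 ^ n) with h | h
    · exact Or.inr h
    · left
      by_contra! hc
      exact Nat.findGreatest_is_greatest (P := P) (Nat.lt_succ_self k) (by omega) ⟨hc, by omega⟩
  refine ⟨k, h2, h1, ?_, hor⟩
  rcases hor with h | h
  · exact h.le
  · rw [h, node_three_pow]
    exact hx.2

lemma interp_eq_of_memCell {p : ℝ} (hp0 : 0 < p) (hp1 : p < 1) {n k : ℕ} {x : ℝ}
    (h : MemCell p n k x) (f : ℕ → ℝ) :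
    interp p n f x =
      f k + (f (k + 1) - f k) * (x - node p n k) / (node p n (k + 1) - node p n k) := by
  classical
  obtain ⟨hk, h1, -, h2⟩ := h
  unfold interp
  have : Nat.findGreatest (fun j => node p n j ≤ x ∧ j < 3 ^ n) (3 ^ n) = k := by
    rw [Nat.findGreatest_eq_iff]
    refine ⟨hk.le, fun _ => ⟨h1, hk⟩, fun j hj _ hPj => ?_⟩
    rcases h2 with h2 | h2
    · have := node_mono hp0 hp1 (show k + 1 ≤ j from hj) hPj.2.le
      linarith [hPj.1]
    · omega
  simp only [this]

/-- Cells are nested. -/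
lemma MemCell.parent {p : ℝ} (hp0 : 0 < p) (hp1 : p < 1) {n k i : ℕ} {x : ℝ} (hi : i < 3)
    (h : MemCell p (n + 1) (3 * k + i) x) : MemCell p n k x := by
  obtain ⟨hk, h1, h2, h3⟩ := h
  rw [pow_succ] at hk h3
  have hl := node_mono hp0 hp1 (n := n + 1) (show 3 * k ≤ 3 * k + i by omega)
    (by rw [pow_succ]; omega)
  have hr := node_mono hp0 hp1 (n := n + 1) (show 3 * k + i + 1 ≤ 3 * (k + 1) by omega)
    (by rw [pow_succ]; omega)
  rw [node_three_mul] at hl hr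
  refine ⟨by omega, hl.trans h1, h2.trans hr, ?_⟩
  rcases h3 with h3 | h3
  · exact Or.inl (h3.trans_le hr)
  · exact Or.inr (by omega)

lemma abs_convex_le {s u v B : ℝ} (hs0 : 0 ≤ s) (hs1 : s ≤ 1) (hu : |u| ≤ B) (hv : |v| ≤ B) :
    |(1 - s) * u + s * v| ≤ B := by
  rw [abs_le] at *
  constructor <;> nlinarith

lemma abs_interp_le {p : ℝ} (hp0 : 0 < p) (hp1 : p < 1) {n : ℕ} {f : ℕ → ℝ} {M : ℝ}
    (hf : ∀ k ≤ 3 ^ n, |f k| ≤ M) {x : ℝ} (hx : x ∈ Set.Icc (0 : ℝ) 1) :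
    |interp p n f x| ≤ M := by
  obtain ⟨k, h⟩ := exists_memCell (p := p) n hx
  rw [interp_eq_of_memCell hp0 hp1 h]
  have hlt := node_lt_succ hp0 hp1 h.1
  have hd : 0 < node p n (k + 1) - node p n k := by linarith
  have := abs_convex_le (s := (x - node p n k) / (node p n (k + 1) - node p n k))
    (div_nonneg (by linarith [h.2.1]) hd.le) ((div_le_one hd).2 (by linarith [h.2.2.1]))
    (hf k h.1.le) (hf (k + 1) h.1)
  convert this using 2
  ring

/-- If the values of `g` at the new nodes are within `B` of the affine interpolation of `f`,
then the two interpolants are uniformly `B`-close. -/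
lemma abs_interp_succ_sub_le {p : ℝ} (hp0 : 0 < p) (hp1 : p < 1) {n : ℕ} {f g : ℕ → ℝ} {B : ℝ}
    (h0 : ∀ k ≤ 3 ^ n, g (3 * k) = f k)
    (h1 : ∀ k < 3 ^ n, |g (3 * k + 1) - (f k + p / (1 + p) * (f (k + 1) - f k))| ≤ B)
    (h2 : ∀ k < 3 ^ n, |g (3 * k + 2) - (f (k + 1) - p / (1 + p) * (f (k + 1) - f k))| ≤ B)
    {x : ℝ} (hx : x ∈ Set.Icc (0 : ℝ) 1) :
    |interp p (n + 1) g x - interp p n f x| ≤ B := by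
  obtain ⟨K, h⟩ := exists_memCell (p := p) (n + 1) hx
  obtain ⟨k, i, hi, rfl⟩ : ∃ k i, i < 3 ∧ K = 3 * k + i := ⟨K / 3, K % 3, by omega, by omega⟩
  have hpar := h.parent hp0 hp1 hi
  rw [interp_eq_of_memCell hp0 hp1 h, interp_eq_of_memCell hp0 hp1 hpar]
  have hk := hpar.1
  have hB : 0 ≤ B := (abs_nonneg _).trans (h1 k hk)
  have hlt := node_lt_succ hp0 hp1 h.1
  have hlt' := node_lt_succ hp0 hp1 hk
  set r := p / (1 + p) with hr
  set X := node p (n + 1) (3 * k + i)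
  set Y := node p (n + 1) (3 * k + i + 1)
  set c := node p n k with hc
  set d := node p n (k + 1) with hd
  have hYX : 0 < Y - X := by linarith
  have hdc : 0 < d - c := by linarith
  have hYX' := hYX.ne'
  have hdc' := hdc.ne'
  have hsplit : g (3 * k + i) + (g (3 * k + i + 1) - g (3 * k + i)) * (x - X) / (Y - X)
      - (f k + (f (k + 1) - f k) * (x - c) / (d - c)) =
      (1 - (x - X) / (Y - X)) * (g (3 * k + i) - (f k + (f (k + 1) - f k) * (X - c) / (d - c)))
      + (x - X) / (Y - X)
        * (g (3 * k + i + 1) - (f k + (f (k + 1) - f k) * (Y - c) / (d - c))) := by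
    field_simp
    ring
  have hnode : ∀ m, m ≤ 3 → |g (3 * k + m) -
      (f k + (f (k + 1) - f k) * (node p (n + 1) (3 * k + m) - c) / (d - c))| ≤ B := by
    intro m hm
    interval_cases m
    · rw [add_zero, h0 k hk.le, node_three_mul, ← hc]
      simpa using hB
    · rw [node_three_mul_add_one, ← hc, ← hd, ← hr]
      convert h1 k hk using 3
      field_simp
      ring
    · rw [node_three_mul_add_two, ← hc, ← hd, ← hr]
      convert h2 k hk using 3
      field_simp
      ring
    · rw [show 3 * k + 3 = 3 * (k + 1) by ring, h0 (k + 1) hk, node_three_mul, ← hd]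
      rw [show f (k + 1) - (f k + (f (k + 1) - f k) * (d - c) / (d - c)) = 0 by field_simp; ring]
      simpa using hB
  rw [hsplit]
  exact abs_convex_le (div_nonneg (by linarith [h.2.1]) hYX.le)
    ((div_le_one hYX).2 (by linarith [h.2.2.1])) (hnode i hi.le) (hnode (i + 1) hi)

lemma sdExt_three_mul (p z : ℝ) (f : ℕ → ℝ) (k : ℕ) : sdExt p z f (3 * k) = f k := by
  simp [sdExt]

lemma sdExt_three_mul_add_one (p z : ℝ) (f : ℕ → ℝ) (k : ℕ) : sdExt p z f (3 * k + 1) =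
    ((1 - p) * (1 - z) * f k + p * (1 - p) * f (k + 1)) / ((1 - p - z) * (1 + p - z)) := by
  have h1 : (3 * k + 1) % 3 = 1 := by omega
  have h2 : (3 * k + 1) / 3 = k := by omega
  simp [sdExt, h1, h2]

lemma sdExt_three_mul_add_two (p z : ℝ) (f : ℕ → ℝ) (k : ℕ) : sdExt p z f (3 * k + 2) =
    ((1 - p) * (1 - z) * f (k + 1) + p * (1 - p) * f k) / ((1 - p - z) * (1 + p - z)) := by
  have h1 : (3 * k + 2) % 3 = 2 := by omega
  have h2 : (3 * k + 2) / 3 = k := by omega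
  simp [sdExt, h1, h2]

/-- The decimation weights differ from the harmonic ones by `O(z)`. -/
lemma abs_decimation_sub_le {p z u v M : ℝ} (hp0 : 0 < p) (hp : p < 1 / 2) (hz0 : 0 ≤ z)
    (hzp : z ≤ p) (hu : |u| ≤ M) (hv : |v| ≤ M) :
    |((1 - p) * (1 - z) * u + p * (1 - p) * v) / ((1 - p - z) * (1 + p - z))
      - (u + p / (1 + p) * (v - u))| ≤ 3 / (1 - 2 * p) * z * M := by
  have hD1 : 0 < 1 - p - z := by linarith
  have hD2 : 0 < 1 + p - z := by linarith
  have hp1 : 0 < 1 + p := by linarith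
  have hM : 0 ≤ M := (abs_nonneg _).trans hu
  have e : ((1 - p) * (1 - z) * u + p * (1 - p) * v) / ((1 - p - z) * (1 + p - z))
      - (u + p / (1 + p) * (v - u)) =
      z * ((2 - (1 + p) * (1 - p) - z) * u + p * (2 - z) * v) /
        ((1 - p - z) * (1 + p - z) * (1 + p)) := by
    field_simp
    ring
  have hnum : |(2 - (1 + p) * (1 - p) - z) * u + p * (2 - z) * v| ≤ 3 * M := by
    have c1 : |2 - (1 + p) * (1 - p) - z| ≤ 2 := by
      rw [abs_le]; constructor <;> nlinarith
    have c2 : |p * (2 - z)| ≤ 1 := by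
      rw [abs_le]; constructor <;> nlinarith
    calc _ ≤ |2 - (1 + p) * (1 - p) - z| * |u| + |p * (2 - z)| * |v| := by
          rw [← abs_mul, ← abs_mul]; exact abs_add_le _ _
      _ ≤ 2 * M + 1 * M := by gcongr
      _ = 3 * M := by ring
  have hden : 1 - 2 * p ≤ (1 - p - z) * (1 + p - z) * (1 + p) := by
    have h1 : 1 - 2 * p ≤ (1 - p - z) * (1 + p - z) := by nlinarith
    nlinarith
  have hq : 0 < 1 - 2 * p := by linarith
  rw [e, abs_div, abs_mul, abs_of_nonneg hz0,
    abs_of_pos (show 0 < (1 - p - z) * (1 + p - z) * (1 + p) by positivity)]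
  calc _ ≤ z * (3 * M) / (1 - 2 * p) := by gcongr
    _ = _ := by ring

lemma abs_sdExt_add_one_sub_le {p z M : ℝ} (hp0 : 0 < p) (hp : p < 1 / 2) (hz0 : 0 ≤ z)
    (hzp : z ≤ p) {n : ℕ} {f : ℕ → ℝ} (hf : ∀ k ≤ 3 ^ n, |f k| ≤ M) {k : ℕ} (hk : k < 3 ^ n) :
    |sdExt p z f (3 * k + 1) - (f k + p / (1 + p) * (f (k + 1) - f k))| ≤
      3 / (1 - 2 * p) * z * M := by
  rw [sdExt_three_mul_add_one]
  exact abs_decimation_sub_le hp0 hp hz0 hzp (hf k hk.le) (hf (k + 1) hk)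

lemma abs_sdExt_add_two_sub_le {p z M : ℝ} (hp0 : 0 < p) (hp : p < 1 / 2) (hz0 : 0 ≤ z)
    (hzp : z ≤ p) {n : ℕ} {f : ℕ → ℝ} (hf : ∀ k ≤ 3 ^ n, |f k| ≤ M) {k : ℕ} (hk : k < 3 ^ n) :
    |sdExt p z f (3 * k + 2) - (f (k + 1) - p / (1 + p) * (f (k + 1) - f k))| ≤
      3 / (1 - 2 * p) * z * M := by
  rw [sdExt_three_mul_add_two]
  convert abs_decimation_sub_le hp0 hp hz0 hzp (hf (k + 1) hk) (hf k hk.le) using 3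
  ring

lemma abs_interp_sdExt_sub_le {p z M : ℝ} (hp0 : 0 < p) (hp : p < 1 / 2) (hz0 : 0 ≤ z)
    (hzp : z ≤ p) {n : ℕ} {f : ℕ → ℝ} (hf : ∀ k ≤ 3 ^ n, |f k| ≤ M) {x : ℝ}
    (hx : x ∈ Set.Icc (0 : ℝ) 1) :
    |interp p (n + 1) (sdExt p z f) x - interp p n f x| ≤ 3 / (1 - 2 * p) * z * M :=
  abs_interp_succ_sub_le hp0 (by linarith) (fun k _ => sdExt_three_mul p z f k)
    (fun _ hk => abs_sdExt_add_one_sub_le hp0 hp hz0 hzp hf hk)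
    (fun _ hk => abs_sdExt_add_two_sub_le hp0 hp hz0 hzp hf hk) hx

lemma abs_sdExt_le {p z M : ℝ} (hp0 : 0 < p) (hp : p < 1 / 2) (hz0 : 0 ≤ z)
    (hzp : z ≤ p) {n : ℕ} {f : ℕ → ℝ} (hf : ∀ k ≤ 3 ^ n, |f k| ≤ M) {m : ℕ}
    (hm : m ≤ 3 ^ (n + 1)) :
    |sdExt p z f m| ≤ (1 + 3 / (1 - 2 * p) * z) * M := by
  have hM : 0 ≤ M := (abs_nonneg _).trans (hf 0 (Nat.zero_le _))
  have hq : 0 < 1 - 2 * p := by linarith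
  have hr0 := ratio_pos hp0
  have hr1 := ratio_lt_half hp0 (by linarith)
  rw [pow_succ] at hm
  obtain ⟨k, rfl | rfl | rfl⟩ := exists_eq_three_mul_add m
  · rw [sdExt_three_mul]
    have : 0 ≤ 3 / (1 - 2 * p) * z * M := by positivity
    linarith [hf k (by omega)]
  · have hk : k < 3 ^ n := by omega
    have h1 := abs_sdExt_add_one_sub_le hp0 hp hz0 hzp hf hk
    have h2 := abs_convex_le hr0.le (by linarith) (hf k hk.le) (hf (k + 1) hk)
    rw [abs_le] at *
    constructor <;> linarith
  · have hk : k < 3 ^ n := by omega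
    have h1 := abs_sdExt_add_two_sub_le hp0 hp hz0 hzp hf hk
    have h2 := abs_convex_le hr0.le (by linarith) (hf (k + 1) hk) (hf k hk.le)
    rw [abs_le] at *
    constructor <;> linarith

/-- The lowest branch of `R⁻¹` is, up to a quadratic error, division by `𝔠 = (2 + pq) / (pq)`. -/
lemma renormalization_step {p w : ℝ} (hp0 : 0 < p) (hp1 : p < 1) (hw0 : 0 ≤ w) (hw1 : w ≤ 1) :
    R p w ≤ (2 + p * (1 - p)) / (p * (1 - p)) * w ∧
      (2 + p * (1 - p)) / (p * (1 - p)) * w - R p w ≤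
        3 / 2 * ((2 + p * (1 - p)) / (p * (1 - p))) * w ^ 2 := by
  have hpq : 0 < p * (1 - p) := mul_pos hp0 (by linarith)
  have e : (2 + p * (1 - p)) / (p * (1 - p)) * w - R p w = w ^ 2 * (3 - w) / (p * (1 - p)) := by
    unfold R
    ring
  have h0 : 0 ≤ w ^ 2 * (3 - w) / (p * (1 - p)) :=
    div_nonneg (mul_nonneg (sq_nonneg w) (by linarith)) hpq.le
  refine ⟨by linarith, ?_⟩
  rw [e, show 3 / 2 * ((2 + p * (1 - p)) / (p * (1 - p))) * w ^ 2 =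
    w ^ 2 * (3 + 3 / 2 * (p * (1 - p))) / (p * (1 - p)) by ring]
  gcongr
  linarith

lemma two_le_renormalization {p : ℝ} (hp0 : 0 < p) (hp1 : p < 1) :
    2 ≤ (2 + p * (1 - p)) / (p * (1 - p)) := by
  have hpq : 0 < p * (1 - p) := mul_pos hp0 (by linarith)
  rw [le_div_iff₀ hpq]
  nlinarith [sq_nonneg (p - 1 / 2)]

lemma abs_sub_limit_le {c B L : ℝ} (hc : 2 ≤ c) {N : ℕ} {u : ℕ → ℝ}
    (hu : ∀ j, |u (j + 1) - u j| ≤ B * (c ^ (N + j))⁻¹)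
    (hL : Filter.Tendsto u Filter.atTop (nhds L)) (j : ℕ) :
    |u j - L| ≤ 2 * B * (c ^ (N + j))⁻¹ := by
  have hc0 : 0 < c := by linarith
  have hr : c⁻¹ ≤ 1 / 2 := by
    rw [inv_le_comm₀ hc0 (by norm_num)]
    linarith
  have hB : 0 ≤ B * (c ^ (N + j))⁻¹ := (abs_nonneg _).trans (hu j)
  have h := dist_le_of_le_geometric_of_tendsto (f := u) c⁻¹ (B * (c ^ N)⁻¹) (by linarith)
    (fun j => by
      rw [dist_comm, Real.dist_eq]
      convert hu j using 1
      rw [pow_add, mul_inv, inv_pow]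
      ring) hL j
  rw [Real.dist_eq] at h
  refine h.trans ?_
  rw [div_le_iff₀ (by linarith), show B * (c ^ N)⁻¹ * c⁻¹ ^ j = B * (c ^ (N + j))⁻¹ by
    rw [pow_add, mul_inv, inv_pow]; ring]
  nlinarith

/-- A nonnegative sequence obtained by iterating the inverse branch. -/
structure IsDecimationSeq (c : ℝ) (N : ℕ) (z : ℕ → ℝ) (L : ℝ) : Prop where
  nonneg : ∀ j, 0 ≤ z j
  le_mul : ∀ j, z j ≤ c * z (j + 1)
  mul_sub_le : ∀ j, c * z (j + 1) - z j ≤ 3 / 2 * c * z (j + 1) ^ 2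
  tendsto : Filter.Tendsto (fun j => c ^ (N + j) * z j) Filter.atTop (nhds L)

namespace IsDecimationSeq

variable {c : ℝ} {N : ℕ} {z : ℕ → ℝ} {L : ℝ}

lemma monotone_renormalized (h : IsDecimationSeq c N z L) (hc : 2 ≤ c) :
    Monotone fun j => c ^ (N + j) * z j :=
  monotone_nat_of_le_succ fun j => by
    have := h.le_mul j
    calc c ^ (N + j) * z j ≤ c ^ (N + j) * (c * z (j + 1)) := by gcongr
      _ = c ^ (N + (j + 1)) * z (j + 1) := by ring

lemma renormalized_le (h : IsDecimationSeq c N z L) (hc : 2 ≤ c) (j : ℕ) :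
    c ^ (N + j) * z j ≤ L :=
  (h.monotone_renormalized hc).ge_of_tendsto h.tendsto j

lemma le_inv_pow (h : IsDecimationSeq c N z L) (hc : 2 ≤ c) (j : ℕ) :
    z j ≤ L * (c ^ (N + j))⁻¹ := by
  rw [← div_eq_mul_inv, le_div_iff₀ (by positivity), mul_comm]
  exact h.renormalized_le hc j

lemma limit_nonneg (h : IsDecimationSeq c N z L) (hc : 2 ≤ c) : 0 ≤ L :=
  (mul_nonneg (by positivity) (h.nonneg 0)).trans (h.renormalized_le hc 0)

lemma abs_renormalized_sub_le (h : IsDecimationSeq c N z L) (hc : 2 ≤ c) (j : ℕ) :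
    |c ^ (N + j) * z j - L| ≤ 2 * (3 / 2 * L ^ 2) * (c ^ (N + j))⁻¹ := by
  refine abs_sub_limit_le hc (fun j => ?_) h.tendsto j
  have hpos : 0 < c ^ (N + j) := by positivity
  have hpos' : 0 < c ^ (N + (j + 1)) := by positivity
  have hz := h.nonneg (j + 1)
  rw [abs_of_nonneg (sub_nonneg.2 (h.monotone_renormalized hc j.le_succ))]
  calc c ^ (N + (j + 1)) * z (j + 1) - c ^ (N + j) * z j
      = c ^ (N + j) * (c * z (j + 1) - z j) := by ring
    _ ≤ c ^ (N + j) * (3 / 2 * c * z (j + 1) ^ 2) := by gcongr; exact h.mul_sub_le j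
    _ = 3 / 2 * (c ^ (N + (j + 1)) * z (j + 1)) ^ 2 * (c ^ (N + (j + 1)))⁻¹ := by
        field_simp
        ring
    _ ≤ 3 / 2 * L ^ 2 * (c ^ (N + j))⁻¹ := by
        gcongr
        · exact h.renormalized_le hc (j + 1)
        · linarith
        · omega

lemma exists_abs_sqrt_sub_le (h : IsDecimationSeq c N z L) (hc : 2 ≤ c) :
    ∃ S ≥ 0, ∀ j, |√(c ^ (N + j) * z j) - √L| ≤ S * (c ^ (N + j))⁻¹ := by
  have hL := h.limit_nonneg hc
  refine ⟨2 * (3 / 2 * L ^ 2) / √L, by positivity, fun j => ?_⟩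
  have ha : 0 ≤ c ^ (N + j) * z j := mul_nonneg (by positivity) (h.nonneg j)
  have haL := h.renormalized_le hc j
  have hs := Real.sqrt_le_sqrt haL
  rcases hL.eq_or_lt with h0 | h0
  · have : c ^ (N + j) * z j = 0 := by linarith
    simp [this, ← h0]
  · have hL0 : 0 < √L := Real.sqrt_pos.2 h0
    have hd := h.abs_renormalized_sub_le hc j
    rw [abs_of_nonpos (by linarith)] at hd ⊢
    rw [div_mul_eq_mul_div, le_div_iff₀ hL0]
    nlinarith [Real.sq_sqrt hL, Real.sq_sqrt ha, Real.sqrt_nonneg (c ^ (N + j) * z j)]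

end IsDecimationSeq

lemma abs_div_sub_div_le {x y X Y y₀ S S' e : ℝ} (hX : 0 ≤ X) (hy₀ : 0 < y₀) (hy : y₀ ≤ y)
    (hY : 0 < Y) (hx : |x - X| ≤ S * e) (hyY : |y - Y| ≤ S' * e) :
    |x / y - X / Y| ≤ (S / y₀ + X * S' / (y₀ * Y)) * e := by
  have hy' : 0 < y := hy₀.trans_le hy
  have e1 : x / y - X / Y = (x - X) / y + X * (Y - y) / (y * Y) := by
    field_simp
    ring
  have h1 : |(x - X) / y| ≤ S * e / y₀ := by
    rw [abs_div, abs_of_pos hy']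
    gcongr
    exact (abs_nonneg _).trans hx
  have h2 : |X * (Y - y) / (y * Y)| ≤ X * (S' * e) / (y₀ * Y) := by
    rw [abs_div, abs_mul, abs_of_nonneg hX, abs_of_pos (mul_pos hy' hY), abs_sub_comm]
    have := (abs_nonneg _).trans hyY
    gcongr
  rw [e1]
  calc _ ≤ S * e / y₀ + X * (S' * e) / (y₀ * Y) := (abs_add_le _ _).trans (add_le_add h1 h2)
    _ = _ := by ring

lemma IsDecimationSeq.exists_abs_sqrt_ratio_sub_le {c : ℝ} (hc : 2 ≤ c) {N : ℕ} {z w : ℕ → ℝ}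
    {L L' : ℝ} (hz : IsDecimationSeq c N z L) (hw : IsDecimationSeq c N w L') (hw0 : 0 < w 0) :
    ∃ D ≥ 0, ∀ j, |√(z j) / √(w j) - √L / √L'| ≤ D * (c ^ (N + j))⁻¹ := by
  obtain ⟨S, hS0, hS⟩ := hz.exists_abs_sqrt_sub_le hc
  obtain ⟨S', hS'0, hS'⟩ := hw.exists_abs_sqrt_sub_le hc
  have hc0 : 0 < c := by linarith
  have hy₀ : 0 < √(c ^ (N + 0) * w 0) := Real.sqrt_pos.2 (by positivity)
  have hY : 0 < √L' := hy₀.trans_le (Real.sqrt_le_sqrt (hw.renormalized_le hc 0))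
  refine ⟨S / √(c ^ (N + 0) * w 0) + √L * S' / (√(c ^ (N + 0) * w 0) * √L'), by positivity,
    fun j => ?_⟩
  have hq : √(z j) / √(w j) = √(c ^ (N + j) * z j) / √(c ^ (N + j) * w j) := by
    have hp : 0 < c ^ (N + j) := by positivity
    rw [Real.sqrt_mul hp.le, Real.sqrt_mul hp.le, mul_div_mul_left _ _ (Real.sqrt_pos.2 hp).ne']
  rw [hq]
  exact abs_div_sub_div_le (Real.sqrt_nonneg L) hy₀
    (Real.sqrt_le_sqrt (hw.monotone_renormalized hc (Nat.zero_le j))) hY (hS j) (hS' j)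

/-- Iterated decimation extensions stay bounded and converge at rate `𝔠⁻ⁿ`. -/
lemma exists_eigenfunction_bounds {p : ℝ} (hp0 : 0 < p) (hp : p < 1 / 2) {c : ℝ} (hc : 2 ≤ c)
    {N : ℕ} {z : ℕ → ℝ} {L : ℝ} (hz0 : ∀ j, 0 ≤ z j) (hzp : ∀ j, z (j + 1) ≤ p)
    (hzL : ∀ j, z j ≤ L * (c ^ (N + j))⁻¹) {f : ℕ → ℕ → ℝ}
    (hf : ∀ j, f (j + 1) = sdExt p (z (j + 1)) (f j)) {F : ℝ → ℝ}
    (hF : ∀ x ∈ Set.Icc (0 : ℝ) 1,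
      Filter.Tendsto (fun j => interp p (N + j) (f j) x) Filter.atTop (nhds (F x))) :
    ∃ M ≥ 0, ∃ B ≥ 0, ∀ j, ∀ x ∈ Set.Icc (0 : ℝ) 1, |interp p (N + j) (f j) x| ≤ M ∧
      |interp p (N + j) (f j) x - F x| ≤ B * (c ^ (N + j))⁻¹ := by
  have hc0 : 0 < c := by linarith
  have hq : 0 < 1 - 2 * p := by linarith
  set κ := 3 / (1 - 2 * p)
  have hκ0 : 0 < κ := by positivity
  have hL : 0 ≤ L := by
    have := (hz0 0).trans (hzL 0)
    exact nonneg_of_mul_nonneg_left this (by positivity)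
  set M₀ := ∑ k ∈ Finset.range (3 ^ N + 1), |f 0 k|
  have hM₀0 : 0 ≤ M₀ := Finset.sum_nonneg fun _ _ => abs_nonneg _
  have hexp : ∀ j, ∀ m ≤ 3 ^ (N + j), |f j m| ≤ M₀ * Real.exp (κ * L * (1 - (c ^ j)⁻¹)) := by
    intro j
    induction j with
    | zero =>
      intro m hm
      simp only [pow_zero, inv_one, sub_self, mul_zero, Real.exp_zero, mul_one]
      exact Finset.single_le_sum (f := fun k => |f 0 k|) (fun _ _ => abs_nonneg _)
        (Finset.mem_range.2 (Nat.lt_succ_of_le hm))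
    | succ j ih =>
      intro m hm
      rw [hf j]
      refine (abs_sdExt_le hp0 hp (hz0 _) (hzp j) ih hm).trans ?_
      have hz : z (j + 1) ≤ L * (c ^ (j + 1))⁻¹ := by
        refine (hzL (j + 1)).trans (mul_le_mul_of_nonneg_left (inv_anti₀ (by positivity) ?_) hL)
        exact pow_le_pow_right₀ (by linarith) (by omega)
      have hhalf : 2 * (c ^ (j + 1))⁻¹ ≤ (c ^ j)⁻¹ := by
        rw [pow_succ, mul_inv]
        have : c⁻¹ ≤ 1 / 2 := by
          rw [inv_le_comm₀ hc0 (by norm_num)]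
          linarith
        have : 0 < (c ^ j)⁻¹ := by positivity
        nlinarith
      have h1 : 1 + κ * z (j + 1) ≤ Real.exp (κ * L * (c ^ (j + 1))⁻¹) := by
        have := Real.add_one_le_exp (κ * L * (c ^ (j + 1))⁻¹)
        nlinarith
      have hκL : 0 ≤ κ * L := by positivity
      calc (1 + κ * z (j + 1)) * (M₀ * Real.exp (κ * L * (1 - (c ^ j)⁻¹)))
          ≤ Real.exp (κ * L * (c ^ (j + 1))⁻¹) *
            (M₀ * Real.exp (κ * L * (1 - (c ^ j)⁻¹))) := by gcongr
        _ = M₀ * Real.exp (κ * L * (c ^ (j + 1))⁻¹ + κ * L * (1 - (c ^ j)⁻¹)) := by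
            rw [Real.exp_add]
            ring
        _ ≤ M₀ * Real.exp (κ * L * (1 - (c ^ (j + 1))⁻¹)) := by
            gcongr
            nlinarith
  set M := M₀ * Real.exp (κ * L)
  have hM0 : 0 ≤ M := by positivity
  have hbd : ∀ j, ∀ m ≤ 3 ^ (N + j), |f j m| ≤ M := by
    intro j m hm
    refine (hexp j m hm).trans ?_
    refine mul_le_mul_of_nonneg_left (Real.exp_le_exp.2 ?_) hM₀0
    have : 0 ≤ κ * L * (c ^ j)⁻¹ := by positivity
    linarith
  refine ⟨M, hM0, 2 * (κ * L * M), by positivity, fun j x hx =>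
    ⟨abs_interp_le hp0 (by linarith) (hbd j) hx, ?_⟩⟩
  refine abs_sub_limit_le (u := fun j => interp p (N + j) (f j) x) hc (fun j => ?_) (hF x hx) j
  simp only [hf j]
  refine (abs_interp_sdExt_sub_le hp0 hp (hz0 _) (hzp j) (hbd j) hx).trans ?_
  have hz : z (j + 1) ≤ L * (c ^ (N + j))⁻¹ := by
    refine (hzL (j + 1)).trans ?_
    gcongr
    · linarith
    · omega
  calc κ * z (j + 1) * M ≤ κ * (L * (c ^ (N + j))⁻¹) * M := by gcongr
    _ = κ * L * M * (c ^ (N + j))⁻¹ := by ring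

lemma abs_mul_cos_sub_le {u v M B D e t s s' : ℝ} (ht : 0 ≤ t) (he : 0 ≤ e) (hB : 0 ≤ B)
    (hM : 0 ≤ M) (hD : 0 ≤ D) (hu : |u| ≤ M) (huv : |u - v| ≤ B * e) (hs : |s - s'| ≤ D * e) :
    |u * Real.cos (t * Real.pi * s) - v * Real.cos (t * Real.pi * s')| ≤
      (B + M * Real.pi * D) * max t 1 * e := by
  have hπ := Real.pi_pos
  have hcos : |Real.cos (t * Real.pi * s) - Real.cos (t * Real.pi * s')| ≤
      t * Real.pi * (D * e) := by
    refine (Real.abs_cos_sub_cos_le _ _).trans ?_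
    rw [← mul_sub, abs_mul, abs_of_nonneg (by positivity : 0 ≤ t * Real.pi)]
    gcongr
  calc |u * Real.cos (t * Real.pi * s) - v * Real.cos (t * Real.pi * s')|
      = |(u - v) * Real.cos (t * Real.pi * s') +
          u * (Real.cos (t * Real.pi * s) - Real.cos (t * Real.pi * s'))| := by ring_nf
    _ ≤ |u - v| * |Real.cos (t * Real.pi * s')| +
          |u| * |Real.cos (t * Real.pi * s) - Real.cos (t * Real.pi * s')| := by
        rw [← abs_mul, ← abs_mul]
        exact abs_add_le _ _
    _ ≤ B * e * 1 + M * (t * Real.pi * (D * e)) := by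
        gcongr
        exact Real.abs_cos_le_one _
    _ = B * 1 * e + M * Real.pi * D * t * e := by ring
    _ ≤ B * max t 1 * e + M * Real.pi * D * max t 1 * e := by
        gcongr
        · exact le_max_right _ _
        · exact le_max_left _ _
    _ = _ := by ring

/-- Convergence of the approximate wave-equation solutions `u_n` (built from the level-`n`
spectral-decimation eigenpairs `fs k (n−n₀)`, `lam k (n−n₀)`) to the limit solution `ũ`
(built from the limit eigenfunctions `fk k` and renormalized eigenvalues `lamlim k`),
with time normalized by `tπ/√λ_{·,1}`:
`sup_x |u_n(x, tπ/√λ_{n,1}) − ũ(x, tπ/√λ₁)| ≤ C·max(t,1)·𝔠^{−n}`. -/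
theorem stmt19 (p : ℝ) (hp0 : 0 < p) (hp : p < 1 / 2)
    (φ : ℝ → ℝ)
    (hφmem : ∀ z ∈ Set.Icc (0 : ℝ) 2, φ z ∈ Set.Icc 0 (min p (1 - p)))
    (hφinv : ∀ z ∈ Set.Icc (0 : ℝ) 2, R p (φ z) = z)
    (n₀ : ℕ) (hn₀ : 1 ≤ n₀)
    (lam : ℕ → ℕ → ℝ) (fs : ℕ → ℕ → ℕ → ℝ)
    -- `lam k 0 = λ_{n₀,k}` are the eigenvalues of `Δ_{n₀}` in increasing order,
    -- with eigenfunctions `fs k 0 = f_{n₀,k}`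
    (hmono : ∀ j k : ℕ, j < k → k ≤ 3 ^ n₀ → lam j 0 < lam k 0)
    (heig : ∀ k ≤ 3 ^ n₀, IsEigen p n₀ (lam k 0) (fs k 0))
    (hcomplete : ∀ z ∈ spec p n₀, ∃ k ≤ 3 ^ n₀, lam k 0 = z)
    -- iterated lowest-branch spectral decimation: `lam k j = λ_{n₀+j,k}`, `fs k j = f_{n₀+j,k}`
    (hlam : ∀ k j : ℕ, lam k (j + 1) = φ (lam k j))
    (hfs : ∀ k j : ℕ, fs k (j + 1) = sdExt p (lam k (j + 1)) (fs k j))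
    -- nonnegative weights summing to 1
    (α : ℕ → ℝ) (hα : ∀ k ≤ 3 ^ n₀, 0 ≤ α k)
    (hαsum : ∑ k ∈ Finset.range (3 ^ n₀ + 1), α k = 1)
    -- the limit eigenfunctions `f_k` (uniform limits on [0,1], which exist)
    (fk : ℕ → ℝ → ℝ)
    (hfk : ∀ k ≤ 3 ^ n₀,
      TendstoUniformlyOn (fun j => interp p (n₀ + j) (fs k j)) (fk k) Filter.atTop
        (Set.Icc 0 1))
    -- the renormalized limit eigenvalues `λ_k = lim_n 𝔠^n λ_{n,k}` (which exist)
    (lamlim : ℕ → ℝ)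
    (hlamlim : ∀ k ≤ 3 ^ n₀,
      Filter.Tendsto
        (fun j => ((2 + p * (1 - p)) / (p * (1 - p))) ^ (n₀ + j) * lam k j)
        Filter.atTop (nhds (lamlim k)))
    -- note: `λ_{n,1} > 0` and `λ₁ > 0`
    (hpos : ∀ j : ℕ, 0 < lam 1 j) (hpos' : 0 < lamlim 1) :
    ∀ T > (0 : ℝ), ∃ C > (0 : ℝ), ∀ t ∈ Set.Icc (0 : ℝ) T, ∀ n : ℕ, n₀ < n →
      ∀ x ∈ Set.Icc (0 : ℝ) 1,
        |(∑ k ∈ Finset.range (3 ^ n₀ + 1),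
            α k * interp p n (fs k (n - n₀)) x *
              Real.cos ((t * Real.pi / Real.sqrt (lam 1 (n - n₀))) *
                Real.sqrt (lam k (n - n₀)))) -
          (∑ k ∈ Finset.range (3 ^ n₀ + 1),
            α k * fk k x *
              Real.cos ((t * Real.pi / Real.sqrt (lamlim 1)) * Real.sqrt (lamlim k)))| ≤
        C * max t 1 * (((2 + p * (1 - p)) / (p * (1 - p))) ^ n)⁻¹ := by
  intro T _
  have hp1 : p < 1 := by linarith
  set c := (2 + p * (1 - p)) / (p * (1 - p))
  have hc : 2 ≤ c := two_le_renormalization hp0 hp1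
  have hlam_mem : ∀ k ≤ 3 ^ n₀, ∀ j, lam k j ∈ Set.Icc (0 : ℝ) 2 := by
    intro k hk j
    induction j with
    | zero => exact (heig k hk).mem_Icc hp0 hp1
    | succ j ih =>
      rw [hlam]
      obtain ⟨h0, h1⟩ := hφmem _ ih
      exact ⟨h0, h1.trans ((min_le_left _ _).trans (by linarith))⟩
  have hlam_le : ∀ k ≤ 3 ^ n₀, ∀ j, lam k (j + 1) ≤ p := fun k hk j => by
    rw [hlam]
    exact (hφmem _ (hlam_mem k hk j)).2.trans (min_le_left _ _)
  have hseq : ∀ k ≤ 3 ^ n₀, IsDecimationSeq c n₀ (lam k) (lamlim k) := fun k hk => by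
    have hstep := fun j => renormalization_step hp0 hp1 (hlam_mem k hk (j + 1)).1
      ((hlam_le k hk j).trans hp1.le)
    have hR : ∀ j, R p (lam k (j + 1)) = lam k j := fun j => by
      rw [hlam]
      exact hφinv _ (hlam_mem k hk j)
    simp only [hR] at hstep
    exact ⟨fun j => (hlam_mem k hk j).1, fun j => (hstep j).1, fun j => (hstep j).2,
      hlamlim k hk⟩
  have hone : 1 ≤ 3 ^ n₀ := Nat.one_le_pow _ _ (by norm_num)
  have hmode : ∀ k, ∃ C ≥ (0 : ℝ), k ≤ 3 ^ n₀ → ∀ t ≥ (0 : ℝ), ∀ j, ∀ x ∈ Set.Icc (0 : ℝ) 1,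
      |α k * interp p (n₀ + j) (fs k j) x *
          Real.cos ((t * Real.pi / √(lam 1 j)) * √(lam k j)) -
        α k * fk k x * Real.cos ((t * Real.pi / √(lamlim 1)) * √(lamlim k))| ≤
      C * max t 1 * (c ^ (n₀ + j))⁻¹ := by
    intro k
    by_cases hk : k ≤ 3 ^ n₀
    swap
    · exact ⟨0, le_rfl, fun h => absurd h hk⟩
    obtain ⟨D, hD0, hD⟩ := (hseq k hk).exists_abs_sqrt_ratio_sub_le hc (hseq 1 hone) (hpos 0)
    obtain ⟨M, hM0, B, hB0, hMB⟩ := exists_eigenfunction_bounds hp0 hp hc (hseq k hk).nonneg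
      (hlam_le k hk) ((hseq k hk).le_inv_pow hc) (hfs k)
      (fun x hx => (hfk k hk).tendsto_at hx)
    have hπ := Real.pi_pos
    refine ⟨|α k| * (B + M * Real.pi * D), by positivity, fun _ t ht j x hx => ?_⟩
    have h := abs_mul_cos_sub_le ht (by positivity) hB0 hM0 hD0 (hMB j x hx).1 (hMB j x hx).2
      (hD j)
    rw [div_mul_comm, div_mul_comm (t * Real.pi), mul_comm (_ / _) (t * Real.pi),
      mul_comm (_ / _) (t * Real.pi), mul_assoc (α k), mul_assoc (α k), ← mul_sub, abs_mul]
    calc _ ≤ |α k| * ((B + M * Real.pi * D) * max t 1 * (c ^ (n₀ + j))⁻¹) := by gcongr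
      _ = _ := by ring
  choose C hC0 hC using hmode
  refine ⟨1 + ∑ k ∈ Finset.range (3 ^ n₀ + 1), C k,
    add_pos_of_pos_of_nonneg one_pos (Finset.sum_nonneg fun k _ => hC0 k), ?_⟩
  intro t ht n hn x hx
  obtain ⟨j, rfl⟩ := Nat.exists_eq_add_of_le hn.le
  rw [Nat.add_sub_cancel_left, ← Finset.sum_sub_distrib]
  refine (Finset.abs_sum_le_sum_abs _ _).trans ?_
  calc _ ≤ ∑ k ∈ Finset.range (3 ^ n₀ + 1), C k * max t 1 * (c ^ (n₀ + j))⁻¹ :=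
        Finset.sum_le_sum fun k hk =>
          hC k (Nat.lt_succ_iff.1 (Finset.mem_range.1 hk)) t ht.1 j x hx
    _ = (∑ k ∈ Finset.range (3 ^ n₀ + 1), C k) * max t 1 * (c ^ (n₀ + j))⁻¹ := by
        rw [Finset.sum_mul, Finset.sum_mul]
    _ ≤ _ := by
        gcongr
        linarith
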